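/- Let f : ℝⁿ → ℝ be continuously differentiable with f and ∇f bounded. Then for every t > 0 and every x ∈ ℝⁿ, the local Poincaré inequalities along the Ornstein–Uhlenbeck semigroup hold: (e^{2t} − 1) |∇Q_t f(x)|² ≤ Q_t(f²)(x) − (Q_t f(x))² ≤ (1 − e^{−2t}) Q_t(|∇f|²)(x). -/

import Mathlib

open MeasureTheory

/-- Standard Gaussian density `φ` on `ℝ`. -/
noncomputable def gaussPdf (x : ℝ) : ℝ := (Real.sqrt (2 * Real.pi))⁻¹ * Real.exp (-(x ^ 2) / 2)

/-- Standard Gaussian cumulative distribution function `Φ`. -/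
noncomputable def gaussCdf (x : ℝ) : ℝ := ∫ t in Set.Iic x, gaussPdf t

/-- Inverse of the Gaussian cdf (quantile function `Φ⁻¹`). -/
noncomputable def gaussQuantile : ℝ → ℝ := Function.invFun gaussCdf

/-- Gaussian isoperimetric profile `I_γ`: `I_γ(v) = φ(Φ⁻¹(v))` on `(0,1)`, `0` at the endpoints. -/
noncomputable def Igauss (v : ℝ) : ℝ :=
  if v = 0 ∨ v = 1 then 0 else gaussPdf (gaussQuantile v)

abbrev En (n : ℕ) := EuclideanSpace ℝ (Fin n)

/-- Standard Gaussian probability measure `γₙ` on `ℝⁿ`. -/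
noncomputable def gaussE (n : ℕ) : Measure (En n) :=
  volume.withDensity (fun x =>
    ENNReal.ofReal ((2 * Real.pi) ^ (-(n : ℝ) / 2) * Real.exp (-‖x‖ ^ 2 / 2)))

/-- Ornstein–Uhlenbeck semigroup `Q_t`. -/
noncomputable def ou (n : ℕ) (t : ℝ) (f : En n → ℝ) (x : En n) : ℝ :=
  ∫ y, f (Real.exp (-t) • x + Real.sqrt (1 - Real.exp (-2 * t)) • y) ∂(gaussE n)

open ProbabilityTheory
open scoped RealInnerProductSpace

/-- The density of the standard Gaussian measure with respect to Lebesgue measure. -/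
noncomputable def gaussDensity (n : ℕ) (x : En n) : ℝ :=
  (2 * Real.pi) ^ (-(n : ℝ) / 2) * Real.exp (-‖x‖ ^ 2 / 2)

lemma gaussDensity_nonneg (n : ℕ) (x : En n) : 0 ≤ gaussDensity n x := by
  unfold gaussDensity; positivity

lemma continuous_gaussDensity (n : ℕ) : Continuous (gaussDensity n) := by
  unfold gaussDensity; fun_prop

lemma gaussE_eq_withDensity (n : ℕ) :
    gaussE n = volume.withDensity (fun x => ENNReal.ofReal (gaussDensity n x)) := rfl

lemma integral_gaussE {n : ℕ} {F : Type*} [NormedAddCommGroup F] [NormedSpace ℝ F]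
    (g : En n → F) : ∫ x, g x ∂(gaussE n) = ∫ x, gaussDensity n x • g x := by
  rw [gaussE_eq_withDensity, integral_withDensity_eq_integral_toReal_smul
    (by have := (continuous_gaussDensity n).measurable; fun_prop) (by simp)]
  simp_rw [ENNReal.toReal_ofReal (gaussDensity_nonneg n _)]

lemma integrable_gaussE_iff {n : ℕ} {F : Type*} [NormedAddCommGroup F] [NormedSpace ℝ F]
    {g : En n → F} :
    Integrable g (gaussE n) ↔ Integrable (fun x => gaussDensity n x • g x) volume := by
  rw [gaussE_eq_withDensity, integrable_withDensity_iff_integrable_smul'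
    (by have := (continuous_gaussDensity n).measurable; fun_prop) (by simp)]
  simp_rw [ENNReal.toReal_ofReal (gaussDensity_nonneg n _)]

lemma integrable_gaussDensity (n : ℕ) : Integrable (gaussDensity n) := by
  have h := (GaussianFourier.integrable_cexp_neg_mul_sq_norm_add (V := En n) (b := 1 / 2) (by norm_num) 0 0).norm
  refine (h.const_mul ((2 * Real.pi) ^ (-(n : ℝ) / 2))).congr (ae_of_all _ fun x => ?_)
  simp only [gaussDensity, Complex.norm_exp]
  congr 2
  simp [← Complex.ofReal_pow]
  ring

lemma gaussE_eq_stdGaussian (n : ℕ) : gaussE n = stdGaussian (En n) := by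
  have : IsFiniteMeasure (gaussE n) :=
    isFiniteMeasure_withDensity_ofReal (integrable_gaussDensity n).hasFiniteIntegral
  refine Measure.ext_of_charFun (funext fun t => ?_)
  have h := GaussianFourier.integral_cexp_neg_mul_sq_norm_add (V := En n) (b := 1 / 2)
    (by norm_num) Complex.I t
  have hpi : (Real.pi : ℂ) / (1 / 2) = ((2 * Real.pi : ℝ) : ℂ) := by push_cast; ring
  have hc : (((2 * Real.pi) ^ (-(n : ℝ) / 2) : ℝ) : ℂ) * ((2 * Real.pi : ℝ) : ℂ) ^ ((n : ℂ) / 2)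
      = 1 := by
    rw [show ((n : ℂ) / 2) = (((n : ℝ) / 2 : ℝ) : ℂ) by push_cast; ring,
      ← Complex.ofReal_cpow (by positivity), ← Complex.ofReal_mul,
      ← Real.rpow_add (by positivity)]
    simp [neg_div]
  rw [charFun_stdGaussian, charFun_apply, integral_gaussE]
  calc ∫ x, gaussDensity n x • Complex.exp (⟪x, t⟫ * Complex.I)
      = ∫ x : En n, (((2 * Real.pi) ^ (-(n : ℝ) / 2) : ℝ) : ℂ) *
          Complex.exp (-(1 / 2) * ‖x‖ ^ 2 + Complex.I * ⟪t, x⟫) := by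
        congr with x
        rw [Complex.exp_add, gaussDensity, Complex.real_smul, real_inner_comm, mul_comm Complex.I]
        push_cast
        rw [mul_assoc]
        congr 3
        ring_nf
    _ = Complex.exp (-‖t‖ ^ 2 / 2) := by
        rw [integral_const_mul, h, hpi, finrank_euclideanSpace_fin, ← mul_assoc, hc, one_mul]
        congr 1
        simp
        ring

instance isGaussian_gaussE (n : ℕ) : IsGaussian (gaussE n) := by
  rw [gaussE_eq_stdGaussian]; infer_instance

lemma hasFDerivAt_gaussDensity (n : ℕ) (x : En n) :
    HasFDerivAt (gaussDensity n) (-gaussDensity n x • innerSL ℝ x) x := by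
  have h := ((((hasStrictFDerivAt_norm_sq x).hasFDerivAt.neg).mul_const (1 / 2 : ℝ)).exp).const_mul
    ((2 * Real.pi) ^ (-(n : ℝ) / 2))
  refine (h.congr_fderiv ?_).congr_of_eventuallyEq (.of_forall fun y => ?_)
  · ext v
    simp [gaussDensity]
    ring_nf
  · simp [gaussDensity, div_eq_mul_inv]

lemma Continuous.integrable_gaussE_of_bound {n : ℕ} {F : Type*} [NormedAddCommGroup F]
    {g : En n → F} (hg : Continuous g) {C : ℝ} (hC : ∀ x, ‖g x‖ ≤ C) :
    Integrable g (gaussE n) :=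
  .of_bound hg.aestronglyMeasurable C (ae_of_all _ hC)

lemma integrable_mul_inner_gaussE {n : ℕ} {g : En n → ℝ} (hg : Continuous g) {C : ℝ}
    (hC : ∀ x, |g x| ≤ C) (v : En n) :
    Integrable (fun y => g y * ⟪v, y⟫) (gaussE n) :=
  ((innerSL ℝ v).integrable_comp IsGaussian.integrable_id).bdd_mul hg.aestronglyMeasurable
    (ae_of_all _ hC)

/-- Gaussian integration by parts. -/
lemma integral_mul_inner_gaussE {n : ℕ} {g : En n → ℝ} (hg : ContDiff ℝ 1 g) {A B : ℝ}
    (hA : ∀ x, |g x| ≤ A) (hB : ∀ x, ‖fderiv ℝ g x‖ ≤ B) (v : En n) :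
    ∫ y, g y * ⟪v, y⟫ ∂(gaussE n) = ∫ y, fderiv ℝ g y v ∂(gaussE n) := by
  have hg' : Continuous fun y => fderiv ℝ g y v := (hg.continuous_fderiv one_ne_zero).clm_apply
    continuous_const
  have hd (y : En n) : fderiv ℝ (gaussDensity n) y v = -(gaussDensity n y * ⟪v, y⟫) := by
    rw [(hasFDerivAt_gaussDensity n y).fderiv, real_inner_comm]
    simp
  have h1 := integrable_gaussE_iff.1 (hg'.integrable_gaussE_of_bound (C := B * ‖v‖) fun x =>
    (fderiv ℝ g x).le_of_opNorm_le (hB x) v)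
  have h2 := integrable_gaussE_iff.1 (integrable_mul_inner_gaussE hg.continuous hA v)
  have h3 := integrable_gaussE_iff.1 (hg.continuous.integrable_gaussE_of_bound hA)
  have key := integral_mul_fderiv_eq_neg_fderiv_mul_of_integrable (μ := volume) (f := g)
    (g := gaussDensity n) (v := v) (h1.congr (.of_forall fun y => by simp [mul_comm]))
    (h2.neg.congr (.of_forall fun y => by simp [hd]; ring))
    (h3.congr (.of_forall fun y => by simp [mul_comm]))
    (fun x _ => hg.differentiable one_ne_zero x)
    (fun x _ => (hasFDerivAt_gaussDensity n x).differentiableAt)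
  rw [integral_gaussE, integral_gaussE]
  simp only [hd, mul_neg, integral_neg, neg_inj] at key
  rw [show (fun y => gaussDensity n y • (g y * ⟪v, y⟫)) =
      fun y => g y * (gaussDensity n y * ⟪v, y⟫) by ext y; simp; ring, key]
  simp_rw [smul_eq_mul, mul_comm]

lemma inner_gradient_eq_fderiv {n : ℕ} (g : En n → ℝ) (x v : En n) :
    ⟪gradient g x, v⟫ = fderiv ℝ g x v := by
  simp [gradient]

lemma norm_gradient_eq_norm_fderiv {n : ℕ} (g : En n → ℝ) (x : En n) :
    ‖gradient g x‖ = ‖fderiv ℝ g x‖ := by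
  simp [gradient]

lemma fderiv_comp_add_smul {n : ℕ} {g : En n → ℝ} (hg : ContDiff ℝ 1 g) (p : En n) (s : ℝ)
    (y : En n) : fderiv ℝ (fun y => g (p + s • y)) y = s • fderiv ℝ g (p + s • y) := by
  have h1 : HasFDerivAt (fun y : En n => p + s • y) (s • ContinuousLinearMap.id ℝ (En n)) y :=
    ((hasFDerivAt_id y).const_smul s).const_add p
  refine ((hg.differentiable one_ne_zero _).hasFDerivAt.comp y h1).fderiv.trans ?_
  ext v
  simp

lemma integral_comp_rotation_gaussE {n : ℕ} {k : En n × En n → ℝ} (hk : Continuous k) (θ : ℝ) :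
    ∫ p, k (ContinuousLinearMap.rotation θ p) ∂((gaussE n).prod (gaussE n)) =
      ∫ p, k p ∂((gaussE n).prod (gaussE n)) := by
  have h0 : (gaussE n)[id] = 0 := by
    rw [gaussE_eq_stdGaussian]
    exact integral_id_stdGaussian
  conv_rhs => rw [← IsGaussian.map_rotation_eq_self h0 θ]
  rw [integral_map (by fun_prop) hk.aestronglyMeasurable]

lemma Continuous.integrable_prod_gaussE_of_bound {n : ℕ} {k : En n × En n → ℝ}
    (hk : Continuous k) {C : ℝ} (hC : ∀ p, |k p| ≤ C) :
    Integrable k ((gaussE n).prod (gaussE n)) :=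
  .of_bound hk.aestronglyMeasurable C (ae_of_all _ hC)

section Interpolation

variable {n : ℕ} {h : En n → ℝ} {A B : ℝ}

lemma hasDerivAt_integral_rotation (hh : ContDiff ℝ 1 h) (hA : ∀ x, |h x| ≤ A)
    (hB : ∀ x, ‖fderiv ℝ h x‖ ≤ B) (θ : ℝ) :
    HasDerivAt (fun θ => ∫ p, h p.1 * h (Real.cos θ • p.1 + Real.sin θ • p.2)
        ∂((gaussE n).prod (gaussE n)))
      (∫ p, h p.1 * fderiv ℝ h (Real.cos θ • p.1 + Real.sin θ • p.2)
        (-Real.sin θ • p.1 + Real.cos θ • p.2) ∂((gaussE n).prod (gaussE n))) θ := by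
  have hc := hh.continuous
  have hc' := hh.continuous_fderiv one_ne_zero
  have hA0 : 0 ≤ A := (abs_nonneg _).trans (hA 0)
  have hB0 : 0 ≤ B := (norm_nonneg _).trans (hB 0)
  have hi : Integrable (fun y : En n => ‖y‖) (gaussE n) := IsGaussian.integrable_id.norm
  refine (hasDerivAt_integral_of_dominated_loc_of_deriv_le (s := Set.univ)
    (bound := fun p : En n × En n => A * (B * (‖p.1‖ + ‖p.2‖)))
    (F' := fun θ p => h p.1 * fderiv ℝ h (Real.cos θ • p.1 + Real.sin θ • p.2)
        (-Real.sin θ • p.1 + Real.cos θ • p.2)) Filter.univ_mem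
    (.of_forall fun θ => Continuous.aestronglyMeasurable (by fun_prop)) ?_
    (Continuous.aestronglyMeasurable (by fun_prop)) ?_ ?_ ?_).2
  · refine Continuous.integrable_prod_gaussE_of_bound (C := A * A) (by fun_prop) fun p => ?_
    rw [abs_mul]
    exact mul_le_mul (hA _) (hA _) (abs_nonneg _) hA0
  · refine ae_of_all _ fun p θ _ => ?_
    rw [norm_mul]
    refine mul_le_mul (hA _) ?_ (norm_nonneg _) hA0
    refine (ContinuousLinearMap.le_of_opNorm_le _ (hB _) _).trans ?_
    refine mul_le_mul_of_nonneg_left ((norm_add_le _ _).trans ?_) hB0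
    rw [norm_smul, norm_smul, norm_neg]
    exact add_le_add (mul_le_of_le_one_left (norm_nonneg _) (Real.abs_sin_le_one θ))
      (mul_le_of_le_one_left (norm_nonneg _) (Real.abs_cos_le_one θ))
  · exact (((hi.comp_fst _).add (hi.comp_snd _)).const_mul B).const_mul A
  · refine ae_of_all _ fun p θ _ => ?_
    have h1 : HasDerivAt (fun θ => Real.cos θ • p.1 + Real.sin θ • p.2)
        (-Real.sin θ • p.1 + Real.cos θ • p.2) θ :=
      ((Real.hasDerivAt_cos θ).smul_const p.1).add ((Real.hasDerivAt_sin θ).smul_const p.2)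
    exact ((hh.differentiable one_ne_zero _).hasFDerivAt.comp_hasDerivAt θ h1).const_mul _

lemma integral_mul_fderiv_rotation (hh : ContDiff ℝ 1 h) (hA : ∀ x, |h x| ≤ A)
    (hB : ∀ x, ‖fderiv ℝ h x‖ ≤ B) (θ : ℝ) :
    ∫ p, h p.1 * fderiv ℝ h (Real.cos θ • p.1 + Real.sin θ • p.2)
        (-Real.sin θ • p.1 + Real.cos θ • p.2) ∂((gaussE n).prod (gaussE n)) =
      -Real.sin θ * ∫ p, fderiv ℝ h (Real.cos θ • p.1 + -Real.sin θ • p.2) (gradient h p.1)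
        ∂((gaussE n).prod (gaussE n)) := by
  have hc := hh.continuous
  have hc' := hh.continuous_fderiv one_ne_zero
  have hg : Continuous (gradient h) := (InnerProductSpace.toDual ℝ (En n)).symm.continuous.comp hc'
  have hA0 : 0 ≤ A := (abs_nonneg _).trans (hA 0)
  have hB0 : 0 ≤ B := (norm_nonneg _).trans (hB 0)
  have hi : Integrable (fun y : En n => ‖y‖) (gaussE n) := IsGaussian.integrable_id.norm
  let k : En n × En n → ℝ := fun p =>
    h (Real.cos θ • p.1 + -Real.sin θ • p.2) * fderiv ℝ h p.1 p.2
  have hk : Continuous k := by unfold k; fun_prop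
  have hki : Integrable k ((gaussE n).prod (gaussE n)) := by
    refine Integrable.mono' (((hi.comp_snd (gaussE n)).const_mul B).const_mul A)
      hk.aestronglyMeasurable (ae_of_all _ fun p => ?_)
    rw [norm_mul]
    exact mul_le_mul (hA _) (ContinuousLinearMap.le_of_opNorm_le _ (hB _) _) (norm_nonneg _) hA0
  have hr (p : En n × En n) : k (ContinuousLinearMap.rotation θ p) =
      h p.1 * fderiv ℝ h (Real.cos θ • p.1 + Real.sin θ • p.2)
        (-Real.sin θ • p.1 + Real.cos θ • p.2) := by
    have : Real.cos θ • (Real.cos θ • p.1 + Real.sin θ • p.2) +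
        -Real.sin θ • (-Real.sin θ • p.1 + Real.cos θ • p.2) = p.1 := by
      linear_combination (norm := module) (Real.cos_sq_add_sin_sq θ) • p.1
    simp only [k, ContinuousLinearMap.rotation_apply, this]
  have hD : Continuous fun p : En n × En n =>
      fderiv ℝ h (Real.cos θ • p.1 + -Real.sin θ • p.2) (gradient h p.1) := by fun_prop
  have hDi := hD.integrable_prod_gaussE_of_bound (C := B * B) fun p =>
    (ContinuousLinearMap.le_of_opNorm_le _ (hB _) _).trans
      (mul_le_mul_of_nonneg_left ((norm_gradient_eq_norm_fderiv h _).trans_le (hB _)) hB0)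
  simp_rw [← hr]
  rw [integral_comp_rotation_gaussE hk, integral_prod _ hki, integral_prod _ hDi,
    ← integral_const_mul]
  congr with u
  have hs : |-Real.sin θ| ≤ 1 := by rw [abs_neg]; exact Real.abs_sin_le_one θ
  have key := integral_mul_inner_gaussE
    (g := fun y => h (Real.cos θ • u + -Real.sin θ • y)) (A := A) (B := B)
    (hh.comp (by fun_prop)) (fun y => hA _)
    (fun y => by
      rw [fderiv_comp_add_smul hh, norm_smul]
      exact (mul_le_of_le_one_left (norm_nonneg _) hs).trans (hB _)) (gradient h u)
  simp only [inner_gradient_eq_fderiv, fderiv_comp_add_smul hh] at key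
  rw [← integral_const_mul]
  exact key

lemma integral_fderiv_gradient_le (hh : ContDiff ℝ 1 h)
    (hB : ∀ x, ‖fderiv ℝ h x‖ ≤ B) (θ : ℝ) :
    ∫ p, fderiv ℝ h (Real.cos θ • p.1 + -Real.sin θ • p.2) (gradient h p.1)
        ∂((gaussE n).prod (gaussE n)) ≤ ∫ y, ‖fderiv ℝ h y‖ ^ 2 ∂(gaussE n) := by
  have hc' := hh.continuous_fderiv one_ne_zero
  have hg : Continuous (gradient h) := (InnerProductSpace.toDual ℝ (En n)).symm.continuous.comp hc'
  have hB0 : 0 ≤ B := (norm_nonneg _).trans (hB 0)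
  have hD : Continuous fun p : En n × En n =>
      fderiv ℝ h (Real.cos θ • p.1 + -Real.sin θ • p.2) (gradient h p.1) := by fun_prop
  have hDi := hD.integrable_prod_gaussE_of_bound (C := B * B) fun p =>
    (ContinuousLinearMap.le_of_opNorm_le _ (hB _) _).trans
      (mul_le_mul_of_nonneg_left ((norm_gradient_eq_norm_fderiv h _).trans_le (hB _)) hB0)
  have hb (x : En n) : |‖fderiv ℝ h x‖ ^ 2| ≤ B ^ 2 := by
    rw [abs_of_nonneg (by positivity)]
    exact pow_le_pow_left₀ (norm_nonneg _) (hB x) 2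
  let k : En n × En n → ℝ := fun p => ‖fderiv ℝ h p.1‖ ^ 2
  have hk : Continuous k := by unfold k; fun_prop
  have hki := hk.integrable_prod_gaussE_of_bound fun p => hb p.1
  have hkr : Continuous fun p => k (ContinuousLinearMap.rotation (-θ) p) := by fun_prop
  have hkri := hkr.integrable_prod_gaussE_of_bound fun p => hb _
  have hfst : ∫ p, k p ∂((gaussE n).prod (gaussE n)) = ∫ y, ‖fderiv ℝ h y‖ ^ 2 ∂(gaussE n) := by
    simp [k, integral_fun_fst (fun y : En n => ‖fderiv ℝ h y‖ ^ 2)]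
  calc _ ≤ ∫ p, (1 / 2) * (k (ContinuousLinearMap.rotation (-θ) p) + k p)
          ∂((gaussE n).prod (gaussE n)) := by
        refine integral_mono hDi ((hkri.add hki).const_mul _) fun p => ?_
        have h1 := (le_abs_self _).trans
          (ContinuousLinearMap.le_opNorm (fderiv ℝ h (Real.cos θ • p.1 + -Real.sin θ • p.2))
            (gradient h p.1))
        rw [norm_gradient_eq_norm_fderiv] at h1
        simp only [k, ContinuousLinearMap.rotation_apply, Real.cos_neg, Real.sin_neg]
        nlinarith [sq_nonneg (‖fderiv ℝ h (Real.cos θ • p.1 + -Real.sin θ • p.2)‖ -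
          ‖fderiv ℝ h p.1‖)]
    _ = _ := by
        rw [integral_const_mul, integral_add hkri hki, integral_comp_rotation_gaussE hk, hfst]
        ring

/-- The Gaussian Poincaré inequality. -/
lemma gaussian_poincare (hh : ContDiff ℝ 1 h) (hA : ∀ x, |h x| ≤ A)
    (hB : ∀ x, ‖fderiv ℝ h x‖ ≤ B) :
    ∫ y, h y ^ 2 ∂(gaussE n) - (∫ y, h y ∂(gaussE n)) ^ 2 ≤
      ∫ y, ‖fderiv ℝ h y‖ ^ 2 ∂(gaussE n) := by
  set V := ∫ y, ‖fderiv ℝ h y‖ ^ 2 ∂(gaussE n)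
  let F : ℝ → ℝ := fun θ => ∫ p, h p.1 * h (Real.cos θ • p.1 + Real.sin θ • p.2)
    ∂((gaussE n).prod (gaussE n))
  have hd (θ : ℝ) := (hasDerivAt_integral_rotation hh hA hB θ).sub
    ((Real.hasDerivAt_cos θ).const_mul V)
  have hmono : MonotoneOn (fun θ => F θ - V * Real.cos θ) (Set.Icc 0 (Real.pi / 2)) := by
    refine monotoneOn_of_deriv_nonneg (convex_Icc _ _)
      (fun θ _ => (hd θ).continuousAt.continuousWithinAt)
      (fun θ _ => (hd θ).differentiableAt.differentiableWithinAt) fun θ hθ => ?_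
    rw [interior_Icc] at hθ
    have hs := Real.sin_nonneg_of_nonneg_of_le_pi hθ.1.le (by linarith [hθ.2, Real.pi_pos])
    refine le_of_le_of_eq ?_ (hd θ).deriv.symm
    rw [integral_mul_fderiv_rotation hh hA hB]
    nlinarith [mul_le_mul_of_nonneg_left (integral_fderiv_gradient_le hh hB θ) hs]
  have hle := hmono (Set.left_mem_Icc.2 (by positivity)) (Set.right_mem_Icc.2 (by positivity))
    (by positivity : (0 : ℝ) ≤ Real.pi / 2)
  have h0 : F 0 = ∫ y, h y ^ 2 ∂(gaussE n) := by
    simp [F, ← sq, integral_fun_fst (fun y : En n => h y ^ 2)]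
  have h1 : F (Real.pi / 2) = (∫ y, h y ∂(gaussE n)) ^ 2 := by
    simp [F, integral_prod_mul, sq]
  simp only [h0, h1, Real.cos_zero, Real.cos_pi_div_two] at hle
  linarith

/-- Bessel's inequality for the projection onto linear functionals, after integrating by parts. -/
lemma sq_norm_integral_gradient_le (hh : ContDiff ℝ 1 h) (hA : ∀ x, |h x| ≤ A)
    (hB : ∀ x, ‖fderiv ℝ h x‖ ≤ B) :
    ‖∫ y, fderiv ℝ h y ∂(gaussE n)‖ ^ 2 ≤
      ∫ y, h y ^ 2 ∂(gaussE n) - (∫ y, h y ∂(gaussE n)) ^ 2 := by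
  set L := ∫ y, fderiv ℝ h y ∂(gaussE n) with hL
  set a := (InnerProductSpace.toDual ℝ (En n)).symm L
  set m := ∫ y, h y ∂(gaussE n) with hm
  have hc := hh.continuous
  have hc' := hh.continuous_fderiv one_ne_zero
  have hhi := hc.integrable_gaussE_of_bound hA
  have hh2i : Integrable (fun y => h y ^ 2) (gaussE n) :=
    (hc.pow 2).integrable_gaussE_of_bound (C := A ^ 2) fun x => by
      rw [Pi.pow_apply, norm_pow]; exact pow_le_pow_left₀ (norm_nonneg _) (hA x) 2
  have hLy (y : En n) : ⟪a, y⟫ = L y := by simp [a]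
  have hna : ⟪a, a⟫ = ‖L‖ ^ 2 := by rw [real_inner_self_eq_norm_sq]; simp [a]
  have h1i : Integrable (fun y => L y) (gaussE n) := IsGaussian.integrable_dual _ L
  have h2i : Integrable (fun y => h y * L y) (gaussE n) := by
    simpa only [hLy] using integrable_mul_inner_gaussE hc hA a
  have h3i : Integrable (fun y => L y ^ 2) (gaussE n) :=
    (IsGaussian.memLp_dual (gaussE n) L 2 (by simp)).integrable_sq
  have h1 : ∫ y, L y ∂(gaussE n) = 0 := by
    rw [gaussE_eq_stdGaussian]; exact integral_strongDual_stdGaussian L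
  have h2 : ∫ y, h y * L y ∂(gaussE n) = ‖L‖ ^ 2 := by
    have := integral_mul_inner_gaussE hh hA hB a
    rw [← ContinuousLinearMap.integral_apply (hc'.integrable_gaussE_of_bound hB), ← hL, ← hLy,
      hna] at this
    simpa only [hLy] using this
  have h3 : ∫ y, L y ^ 2 ∂(gaussE n) = ‖L‖ ^ 2 := by
    rw [← variance_dual_stdGaussian, ← gaussE_eq_stdGaussian, variance_eq_integral (by fun_prop)]
    simp [h1]
  have hpos : 0 ≤ ∫ y, (h y - m - L y) ^ 2 ∂(gaussE n) := integral_nonneg fun y => sq_nonneg _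
  have hexp : ∫ y, (h y - m - L y) ^ 2 ∂(gaussE n) =
      ∫ y, (h y ^ 2 - 2 * m * h y + m ^ 2 + 2 * m * L y - 2 * (h y * L y) + L y ^ 2)
        ∂(gaussE n) := by
    congr with y; ring
  rw [hexp, integral_add (by fun_prop) h3i, integral_sub (by fun_prop) (by fun_prop),
    integral_add (by fun_prop) (by fun_prop), integral_add (by fun_prop) (by fun_prop),
    integral_sub hh2i (by fun_prop)] at hpos
  simp only [integral_const_mul, h1, h2, h3, ← hm] at hpos
  simp at hpos
  linarith

end Interpolation

lemma hasFDerivAt_ou {n : ℕ} {f : En n → ℝ} (hf : ContDiff ℝ 1 f) {A B : ℝ}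
    (hA : ∀ x, |f x| ≤ A) (hB : ∀ x, ‖fderiv ℝ f x‖ ≤ B) (t : ℝ) (x : En n) :
    HasFDerivAt (ou n t f) (Real.exp (-t) • ∫ y, fderiv ℝ f
      (Real.exp (-t) • x + Real.sqrt (1 - Real.exp (-2 * t)) • y) ∂(gaussE n)) x := by
  have hc := hf.continuous
  have hc' := hf.continuous_fderiv one_ne_zero
  rw [← integral_smul]
  refine hasFDerivAt_integral_of_dominated_of_fderiv_le (s := Set.univ)
    (bound := fun _ => Real.exp (-t) * B)
    (F' := fun x y => Real.exp (-t) • fderiv ℝ f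
      (Real.exp (-t) • x + Real.sqrt (1 - Real.exp (-2 * t)) • y)) Filter.univ_mem
    (.of_forall fun x => Continuous.aestronglyMeasurable (by fun_prop))
    (Continuous.integrable_gaussE_of_bound (by fun_prop) fun y => hA _)
    (Continuous.aestronglyMeasurable (by fun_prop)) ?_ (integrable_const _) ?_
  · refine ae_of_all _ fun y x _ => ?_
    rw [norm_smul, Real.norm_of_nonneg (Real.exp_nonneg _)]
    exact mul_le_mul_of_nonneg_left (hB _) (Real.exp_nonneg _)
  · refine ae_of_all _ fun y x _ => ?_
    have h1 : HasFDerivAt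
        (fun x : En n => Real.exp (-t) • x + Real.sqrt (1 - Real.exp (-2 * t)) • y)
        (Real.exp (-t) • ContinuousLinearMap.id ℝ (En n)) x :=
      ((hasFDerivAt_id x).const_smul (Real.exp (-t))).add_const
        (Real.sqrt (1 - Real.exp (-2 * t)) • y)
    refine ((hf.differentiable one_ne_zero _).hasFDerivAt.comp x h1).congr_fderiv ?_
    ext v
    simp

/-- Local Poincaré inequalities along the Ornstein–Uhlenbeck semigroup. -/
theorem local_poincare_ou {n : ℕ} (f : En n → ℝ)
    (hf : ContDiff ℝ 1 f) (Mf : ℝ) (hMf : ∀ x, |f x| ≤ Mf)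
    (M : ℝ) (hM : ∀ x, ‖fderiv ℝ f x‖ ≤ M)
    (t : ℝ) (ht : 0 < t) (x : En n) :
    (Real.exp (2 * t) - 1) * ‖gradient (ou n t f) x‖ ^ 2 ≤
        ou n t (fun y => (f y) ^ 2) x - (ou n t f x) ^ 2 ∧
    ou n t (fun y => (f y) ^ 2) x - (ou n t f x) ^ 2 ≤
        (1 - Real.exp (-2 * t)) * ou n t (fun y => ‖gradient f y‖ ^ 2) x := by
  set σ := Real.sqrt (1 - Real.exp (-2 * t)) with hσ
  have hσ2 : σ ^ 2 = 1 - Real.exp (-2 * t) :=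
    Real.sq_sqrt (sub_nonneg.2 (Real.exp_le_one_iff.2 (by linarith)))
  let h : En n → ℝ := fun y => f (Real.exp (-t) • x + σ • y)
  have hh : ContDiff ℝ 1 h := hf.comp (by fun_prop)
  have hA (y : En n) : |h y| ≤ Mf := hMf _
  have hd (y : En n) : fderiv ℝ h y = σ • fderiv ℝ f (Real.exp (-t) • x + σ • y) :=
    fderiv_comp_add_smul hf _ _ _
  have hB (y : En n) : ‖fderiv ℝ h y‖ ≤ σ * M := by
    rw [hd, norm_smul, Real.norm_of_nonneg (Real.sqrt_nonneg _)]
    exact mul_le_mul_of_nonneg_left (hM _) (Real.sqrt_nonneg _)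
  constructor
  · refine le_of_eq_of_le ?_ (sq_norm_integral_gradient_le hh hA hB)
    rw [norm_gradient_eq_norm_fderiv, (hasFDerivAt_ou hf hMf hM t x).fderiv, funext hd,
      integral_smul, norm_smul, norm_smul, mul_pow, mul_pow, Real.norm_eq_abs, Real.norm_eq_abs,
      sq_abs, sq_abs, hσ2, ← mul_assoc, ← Real.exp_nat_mul, sub_mul, ← Real.exp_add]
    congr 2 <;> simp
  · refine (gaussian_poincare hh hA hB).trans_eq ?_
    simp_rw [hd, norm_smul, mul_pow, Real.norm_eq_abs, sq_abs, hσ2]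
    rw [integral_const_mul]
    simp only [ou, norm_gradient_eq_norm_fderiv, ← hσ]
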